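/- For every ð > 0 there exist λ₁ ∈ (0,1) and a constant C > 0 such that for every λ ∈ (0,λ₁) and every pair of signs σ₁, σ₂ ∈ {−1,+1} there exist smooth functions Ψ̃₀, Ψ̃₁ : 𝕋^d × 𝕋^d → [0,1] with Ψ̃₁ = 1 − Ψ̃₀ satisfying: (A) Ψ̃₁(k₁,k₂) = 0 whenever σ₁k₁ + σ₂k₂ = 0 in 𝕋^d, or σ₁k₁ − σ₂k₂ = 0 in 𝕋^d, or k₁ = 0, or k₂ = 0; (B) for i ∈ {1,2}, Ψ̃₁(k₁,k₂) ≤ C·⟨ln λ⟩^{ð/3}·d(k_i, S), and moreover Ψ̃₁(k₁,k₂) ≤ C·⟨ln λ⟩^{ð/3}·d(σ₁k₁ + σ₂k₂, S) and Ψ̃₁(k₁,k₂) ≤ C·⟨ln λ⟩^{ð/3}·d(σ₁k₁ − σ₂k₂, S); (C) 0 ≤ Ψ̃₀(k₁,k₂) ≤ 1{d(σ₁k₁+σ₂k₂, S) < ⟨ln λ⟩^{−ð/3}} + 1{d(σ₁k₁−σ₂k₂, S) < ⟨ln λ⟩^{−ð/3}} + ∑_{i=1,2} 1{d(k_i, S)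 < ⟨ln λ⟩^{−ð/3}}, where 1{·} denotes the indicator of the corresponding set. -/

import Mathlib

open scoped Real

/-- The one-dimensional singular set `S_one = {0, ±1/2, ±1/4} ⊂ 𝕋 = ℝ/ℤ`. -/
def Sone : Set (AddCircle (1 : ℝ)) :=
  {((0 : ℝ) : AddCircle (1 : ℝ)), ((1 / 2 : ℝ) : AddCircle (1 : ℝ)),
    ((-(1 / 2) : ℝ) : AddCircle (1 : ℝ)), ((1 / 4 : ℝ) : AddCircle (1 : ℝ)),
    ((-(1 / 4) : ℝ) : AddCircle (1 : ℝ))}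

/-- The singular manifold `S ⊂ 𝕋^d`: points with at least one coordinate in `S_one`. -/
def singS (d : ℕ) : Set (Fin d → AddCircle (1 : ℝ)) :=
  {k | ∃ j, k j ∈ Sone}

/-- The Japanese bracket `⟨x⟩ = (1 + x²)^{1/2}`. -/
noncomputable def jap (x : ℝ) : ℝ := Real.sqrt (1 + x ^ 2)

/-- A smooth function on `ℝ` vanishing near `ℤ/4` and equal to `1` at distance at least `δ`
from it. -/
noncomputable def cutoffReal (δ x : ℝ) : ℝ :=
  Real.smoothTransition (2 * (Real.sin (4 * π * x) / (8 * δ)) ^ 2 - 1)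

lemma cutoffReal_periodic (δ : ℝ) : Function.Periodic (cutoffReal δ) 1 := by
  intro x
  have h : 4 * π * (x + 1) = 4 * π * x + (2 : ℕ) * (2 * π) := by push_cast; ring
  simp only [cutoffReal]
  rw [h, Real.sin_add_nat_mul_two_pi]

lemma contDiff_cutoffReal (δ : ℝ) : ContDiff ℝ (⊤ : ℕ∞) (cutoffReal δ) := by
  unfold cutoffReal
  exact Real.smoothTransition.contDiff.comp (by fun_prop)

/-- The function induced by `cutoffReal δ` on the circle. -/
noncomputable def cutoffCircle (δ : ℝ) : AddCircle (1 : ℝ) → ℝ :=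
  (cutoffReal_periodic δ).lift

lemma cutoffCircle_coe (δ x : ℝ) : cutoffCircle δ (x : AddCircle (1 : ℝ)) = cutoffReal δ x :=
  (cutoffReal_periodic δ).lift_coe x

lemma cutoffCircle_mem_Icc (δ : ℝ) (u : AddCircle (1 : ℝ)) :
    cutoffCircle δ u ∈ Set.Icc (0 : ℝ) 1 := by
  induction u using QuotientAddGroup.induction_on with
  | H x =>
    rw [cutoffCircle_coe]
    exact ⟨Real.smoothTransition.nonneg _, Real.smoothTransition.le_one _⟩

lemma cutoffReal_le {δ : ℝ} (hδ : 0 < δ) (x : ℝ) :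
    cutoffReal δ x ≤ |Real.sin (4 * π * x)| / (4 * δ) := by
  set s := Real.sin (4 * π * x) / (8 * δ) with hs
  have h : |Real.sin (4 * π * x)| / (4 * δ) = 2 * |s| := by
    rw [hs, abs_div, abs_of_pos (by positivity : 0 < 8 * δ)]
    field_simp
    ring
  rw [h]
  unfold cutoffReal
  rw [← hs]
  by_cases hle : 2 * s ^ 2 - 1 ≤ 0
  · rw [Real.smoothTransition.zero_of_nonpos hle]
    positivity
  · refine (Real.smoothTransition.le_one _).trans ?_
    nlinarith [sq_abs s, abs_nonneg s]

lemma cutoffReal_eq_one {δ x : ℝ} (hδ : 0 < δ) (h : 8 * δ ≤ |Real.sin (4 * π * x)|) :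
    cutoffReal δ x = 1 := by
  refine Real.smoothTransition.one_of_one_le ?_
  have h1 : 1 ≤ |Real.sin (4 * π * x) / (8 * δ)| := by
    rw [abs_div, abs_of_pos (by positivity : 0 < 8 * δ), le_div_iff₀ (by positivity)]
    linarith
  nlinarith [sq_abs (Real.sin (4 * π * x) / (8 * δ))]

lemma exists_coe_of_mem_Sone {v : AddCircle (1 : ℝ)} (hv : v ∈ Sone) :
    ∃ n : ℤ, v = ((n / 4 : ℝ) : AddCircle (1 : ℝ)) := by
  rcases hv with rfl | rfl | rfl | rfl | rfl
  · exact ⟨0, by norm_num⟩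
  · exact ⟨2, by norm_num⟩
  · exact ⟨-2, by norm_num⟩
  · exact ⟨1, by norm_num⟩
  · exact ⟨-1, by norm_num⟩

lemma coe_add_int (q : ℤ) (x : ℝ) :
    ((q + x : ℝ) : AddCircle (1 : ℝ)) = (x : AddCircle (1 : ℝ)) := by
  rw [AddCircle.coe_add, add_eq_right, AddCircle.coe_eq_zero_iff]
  exact ⟨q, by simp⟩

lemma coe_int_div_four_mem_Sone (n : ℤ) : ((n / 4 : ℝ) : AddCircle (1 : ℝ)) ∈ Sone := by
  obtain ⟨q, r, hr, rfl⟩ : ∃ q r : ℤ, (r = 0 ∨ r = 1 ∨ r = 2 ∨ r = -1) ∧ n = 4 * q + r := by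
    by_cases h : n % 4 = 3
    · exact ⟨n / 4 + 1, -1, by simp, by omega⟩
    · exact ⟨n / 4, n % 4, by omega, by omega⟩
  have h : (((4 * q + r : ℤ) / 4 : ℝ) : AddCircle (1 : ℝ)) = ((r / 4 : ℝ) : AddCircle (1 : ℝ)) := by
    rw [← coe_add_int q (r / 4)]
    congr 1
    push_cast
    ring
  rw [h, Sone]
  rcases hr with rfl | rfl | rfl | rfl <;> norm_num

lemma abs_sin_four_pi_add (n : ℤ) (r : ℝ) :
    |Real.sin (4 * π * (n / 4 + r))| = |Real.sin (4 * π * r)| := by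
  have h : 4 * π * (n / 4 + r) = 4 * π * r + n * π := by ring
  rw [h, Real.sin_add_int_mul_pi, abs_mul]
  simp [abs_zpow]

lemma cutoffCircle_le_dist {δ : ℝ} (hδ : 0 < δ) (u : AddCircle (1 : ℝ)) {v : AddCircle (1 : ℝ)}
    (hv : v ∈ Sone) : cutoffCircle δ u ≤ π * δ⁻¹ * dist u v := by
  obtain ⟨n, rfl⟩ := exists_coe_of_mem_Sone hv
  induction u using QuotientAddGroup.induction_on with
  | H x =>
    rw [cutoffCircle_coe]
    refine (cutoffReal_le hδ x).trans ?_
    set r : ℝ := x - n / 4 - round (x - n / 4) with hr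
    have hdist : dist (x : AddCircle (1 : ℝ)) ((n / 4 : ℝ) : AddCircle (1 : ℝ)) = |r| := by
      rw [dist_eq_norm, ← AddCircle.coe_sub, AddCircle.norm_eq]
      simp [hr]
    have hx : x = (n + 4 * round (x - n / 4) : ℤ) / 4 + r := by
      rw [hr]
      push_cast
      ring
    have hsin : |Real.sin (4 * π * x)| ≤ 4 * π * |r| := by
      rw [hx, abs_sin_four_pi_add]
      refine Real.abs_sin_le_abs.trans_eq ?_
      rw [abs_mul, abs_of_pos (by positivity)]
    rw [hdist, div_le_iff₀ (by positivity)]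
    refine hsin.trans_eq ?_
    field_simp

lemma exists_mem_Sone_dist_le (x : ℝ) :
    ∃ v ∈ Sone, 8 * dist (x : AddCircle (1 : ℝ)) v ≤ |Real.sin (4 * π * x)| := by
  set r : ℝ := x - round (4 * x) / 4 with hr
  refine ⟨_, coe_int_div_four_mem_Sone (round (4 * x)), ?_⟩
  have hdist : dist (x : AddCircle (1 : ℝ)) ((round (4 * x) / 4 : ℝ) : AddCircle (1 : ℝ)) ≤ |r| := by
    rw [dist_eq_norm, ← AddCircle.coe_sub]
    rw [AddCircle.norm_eq]
    simpa using round_le r 0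
  have hx : x = round (4 * x) / 4 + r := by ring
  have hr8 : |r| ≤ 1 / 8 := by
    have h := abs_sub_round (4 * x)
    have h4 : 4 * x - round (4 * x) = 4 * r := by ring
    rw [h4, abs_mul, abs_of_pos (by norm_num : (0 : ℝ) < 4)] at h
    linarith
  have habs : |4 * π * r| = 4 * π * |r| := by rw [abs_mul, abs_of_pos (by positivity)]
  have hsin : 8 * |r| ≤ |Real.sin (4 * π * x)| := by
    have h := Real.mul_abs_le_abs_sin (x := 4 * π * r) (by
      rw [habs]
      nlinarith [Real.pi_pos])
    rw [habs] at h
    have hpi : 2 / π * (4 * π * |r|) = 8 * |r| := by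
      field_simp
      ring
    rw [hpi, ← abs_sin_four_pi_add (round (4 * x)) r, ← hx] at h
    exact h
  linarith

/-- The product over all coordinates of the circle cut-offs: a cut-off away from `singS d`. -/
noncomputable def cutoffTorus {d : ℕ} (δ : ℝ) (k : Fin d → AddCircle (1 : ℝ)) : ℝ :=
  ∏ j, cutoffCircle δ (k j)

section cutoffTorus

variable {d : ℕ} {δ : ℝ}

lemma cutoffTorus_mem_Icc (δ : ℝ) (k : Fin d → AddCircle (1 : ℝ)) :
    cutoffTorus δ k ∈ Set.Icc (0 : ℝ) 1 :=
  ⟨Finset.prod_nonneg fun j _ => (cutoffCircle_mem_Icc δ (k j)).1,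
    Finset.prod_le_one (fun j _ => (cutoffCircle_mem_Icc δ (k j)).1)
      fun j _ => (cutoffCircle_mem_Icc δ (k j)).2⟩

lemma cutoffTorus_le_cutoffCircle (δ : ℝ) (k : Fin d → AddCircle (1 : ℝ)) (j : Fin d) :
    cutoffTorus δ k ≤ cutoffCircle δ (k j) := by
  rw [cutoffTorus, ← Finset.mul_prod_erase _ _ (Finset.mem_univ j)]
  exact mul_le_of_le_one_right (cutoffCircle_mem_Icc δ (k j)).1
    (Finset.prod_le_one (fun i _ => (cutoffCircle_mem_Icc δ (k i)).1)
      fun i _ => (cutoffCircle_mem_Icc δ (k i)).2)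

lemma contDiff_cutoffTorus {E : Type*} [NormedAddCommGroup E] [NormedSpace ℝ E] (δ : ℝ)
    {f : E → Fin d → ℝ} (hf : ContDiff ℝ (⊤ : ℕ∞) f) :
    ContDiff ℝ (⊤ : ℕ∞) fun x => cutoffTorus δ fun j => (f x j : AddCircle (1 : ℝ)) := by
  simp only [cutoffTorus, cutoffCircle_coe]
  exact contDiff_prod fun j _ => (contDiff_cutoffReal δ).comp (contDiff_pi.1 hf j)

lemma zero_mem_singS (hd : 0 < d) : (0 : Fin d → AddCircle (1 : ℝ)) ∈ singS d :=
  ⟨⟨0, hd⟩, by simp [Sone]⟩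

lemma cutoffTorus_le_infDist (hd : 0 < d) (hδ : 0 < δ) (k : Fin d → AddCircle (1 : ℝ)) :
    cutoffTorus δ k ≤ π * δ⁻¹ * Metric.infDist k (singS d) := by
  have hpos : 0 < π * δ⁻¹ := by positivity
  rw [← div_le_iff₀' hpos, Metric.le_infDist ⟨0, zero_mem_singS hd⟩]
  rintro s ⟨j, hj⟩
  rw [div_le_iff₀' hpos]
  exact (cutoffTorus_le_cutoffCircle δ k j).trans <| (cutoffCircle_le_dist hδ (k j) hj).trans <|
    mul_le_mul_of_nonneg_left (dist_le_pi_dist k s j) hpos.le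

lemma cutoffTorus_eq_one (hδ : 0 < δ) {k : Fin d → AddCircle (1 : ℝ)}
    (hk : δ ≤ Metric.infDist k (singS d)) : cutoffTorus δ k = 1 := by
  refine Finset.prod_eq_one fun j _ => ?_
  obtain ⟨x, hx⟩ := QuotientAddGroup.mk_surjective (k j)
  obtain ⟨v, hv, hdist⟩ := exists_mem_Sone_dist_le x
  rw [← hx]
  refine (cutoffCircle_coe δ x).trans (cutoffReal_eq_one hδ ?_)
  have hmem : Function.update k j v ∈ singS d := ⟨j, by simpa using hv⟩
  have hle : dist k (Function.update k j v) ≤ dist (k j) v := by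
    refine (dist_pi_le_iff dist_nonneg).2 fun i => ?_
    rcases eq_or_ne i j with rfl | hij
    · simp
    · simp [hij]
  have h := (hk.trans (Metric.infDist_le_dist_of_mem hmem)).trans hle
  rw [← hx] at h
  exact (mul_le_mul_of_nonneg_left h (by norm_num)).trans hdist

end cutoffTorus

lemma zsmul_coe_circle (n : ℤ) (x : ℝ) :
    n • (x : AddCircle (1 : ℝ)) = ((n * x : ℝ) : AddCircle (1 : ℝ)) := by
  rw [← AddCircle.coe_zsmul, zsmul_eq_mul]

/-- Existence of the cut-off functions `Ψ̃₀, Ψ̃₁ = 1 − Ψ̃₀` on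
`𝕋^d × 𝕋^d`, smooth (their lifts to `ℝ^{2d}` are `C^∞`), with values in `[0,1]`,
vanishing of `Ψ̃₁` at the degenerate configurations (A), the distance bounds (B), and
the indicator bound (C) on `Ψ̃₀`. -/
theorem cutoff_functions_exist (d : ℕ) (hd : 2 ≤ d) (eth : ℝ) (heth : 0 < eth) :
    ∃ lam₁ ∈ Set.Ioo (0 : ℝ) 1, ∃ C : ℝ, 0 < C ∧
      ∀ lam ∈ Set.Ioo (0 : ℝ) lam₁, ∀ σ₁ σ₂ : ℤ,
        (σ₁ = 1 ∨ σ₁ = -1) → (σ₂ = 1 ∨ σ₂ = -1) →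
        ∃ Ψ₀ Ψ₁ : (Fin d → AddCircle (1 : ℝ)) → (Fin d → AddCircle (1 : ℝ)) → ℝ,
          (∀ k₁ k₂, Ψ₁ k₁ k₂ = 1 - Ψ₀ k₁ k₂) ∧
          (∀ k₁ k₂, Ψ₀ k₁ k₂ ∈ Set.Icc (0 : ℝ) 1) ∧
          (∀ k₁ k₂, Ψ₁ k₁ k₂ ∈ Set.Icc (0 : ℝ) 1) ∧
          ContDiff ℝ (⊤ : ℕ∞) (fun x : (Fin d → ℝ) × (Fin d → ℝ) =>
            Ψ₀ (fun j => (x.1 j : AddCircle (1 : ℝ)))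
              (fun j => (x.2 j : AddCircle (1 : ℝ)))) ∧
          ContDiff ℝ (⊤ : ℕ∞) (fun x : (Fin d → ℝ) × (Fin d → ℝ) =>
            Ψ₁ (fun j => (x.1 j : AddCircle (1 : ℝ)))
              (fun j => (x.2 j : AddCircle (1 : ℝ)))) ∧
          -- (A)
          (∀ k₁ k₂ : Fin d → AddCircle (1 : ℝ),
            (σ₁ • k₁ + σ₂ • k₂ = 0 ∨ σ₁ • k₁ - σ₂ • k₂ = 0 ∨ k₁ = 0 ∨ k₂ = 0) →
              Ψ₁ k₁ k₂ = 0) ∧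
          -- (B)
          (∀ k₁ k₂ : Fin d → AddCircle (1 : ℝ),
            Ψ₁ k₁ k₂ ≤ C * jap (Real.log lam) ^ (eth / 3) * Metric.infDist k₁ (singS d) ∧
            Ψ₁ k₁ k₂ ≤ C * jap (Real.log lam) ^ (eth / 3) * Metric.infDist k₂ (singS d) ∧
            Ψ₁ k₁ k₂ ≤ C * jap (Real.log lam) ^ (eth / 3) *
              Metric.infDist (σ₁ • k₁ + σ₂ • k₂) (singS d) ∧
            Ψ₁ k₁ k₂ ≤ C * jap (Real.log lam) ^ (eth / 3) *
              Metric.infDist (σ₁ • k₁ - σ₂ • k₂) (singS d)) ∧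
          -- (C)
          (∀ k₁ k₂ : Fin d → AddCircle (1 : ℝ),
            Ψ₀ k₁ k₂ ≤
              (if Metric.infDist (σ₁ • k₁ + σ₂ • k₂) (singS d) <
                  jap (Real.log lam) ^ (-(eth / 3)) then (1 : ℝ) else 0) +
              (if Metric.infDist (σ₁ • k₁ - σ₂ • k₂) (singS d) <
                  jap (Real.log lam) ^ (-(eth / 3)) then (1 : ℝ) else 0) +
              (if Metric.infDist k₁ (singS d) <
                  jap (Real.log lam) ^ (-(eth / 3)) then (1 : ℝ) else 0) +
              (if Metric.infDist k₂ (singS d) <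
                  jap (Real.log lam) ^ (-(eth / 3)) then (1 : ℝ) else 0)) := by
  refine ⟨1 / 2, by norm_num, π, Real.pi_pos, fun lam _ σ₁ σ₂ _ _ => ?_⟩
  have hd0 : 0 < d := by omega
  have hjap : 0 < jap (Real.log lam) := Real.sqrt_pos.2 (by positivity)
  set δ := jap (Real.log lam) ^ (-(eth / 3)) with hδ_def
  have hδ : 0 < δ := Real.rpow_pos_of_pos hjap _
  have hinv : jap (Real.log lam) ^ (eth / 3) = δ⁻¹ := by
    rw [hδ_def, Real.rpow_neg hjap.le, inv_inv]
  rw [hinv]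
  let Ψ : (Fin d → AddCircle (1 : ℝ)) → (Fin d → AddCircle (1 : ℝ)) → ℝ := fun k₁ k₂ =>
    cutoffTorus δ k₁ * cutoffTorus δ k₂ * cutoffTorus δ (σ₁ • k₁ + σ₂ • k₂) *
      cutoffTorus δ (σ₁ • k₁ - σ₂ • k₂)
  have hIcc : ∀ k₁ k₂, Ψ k₁ k₂ ∈ Set.Icc (0 : ℝ) 1 := fun k₁ k₂ =>
    unitInterval.mul_mem (unitInterval.mul_mem (unitInterval.mul_mem (cutoffTorus_mem_Icc δ _)
      (cutoffTorus_mem_Icc δ _)) (cutoffTorus_mem_Icc δ _)) (cutoffTorus_mem_Icc δ _)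
  have hsmooth : ContDiff ℝ (⊤ : ℕ∞) (fun x : (Fin d → ℝ) × (Fin d → ℝ) =>
      Ψ (fun j => (x.1 j : AddCircle (1 : ℝ))) (fun j => (x.2 j : AddCircle (1 : ℝ)))) := by
    have hadd : ∀ x : (Fin d → ℝ) × (Fin d → ℝ),
        σ₁ • (fun j => (x.1 j : AddCircle (1 : ℝ))) + σ₂ • (fun j => (x.2 j : AddCircle (1 : ℝ))) =
          fun j => (((σ₁ : ℝ) • x.1 + (σ₂ : ℝ) • x.2) j : AddCircle (1 : ℝ)) := fun x => by
      funext j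
      exact (congrArg₂ (· + ·) (zsmul_coe_circle _ _) (zsmul_coe_circle _ _)).trans
        (AddCircle.coe_add (1 : ℝ) _ _).symm
    have hsub : ∀ x : (Fin d → ℝ) × (Fin d → ℝ),
        σ₁ • (fun j => (x.1 j : AddCircle (1 : ℝ))) - σ₂ • (fun j => (x.2 j : AddCircle (1 : ℝ))) =
          fun j => (((σ₁ : ℝ) • x.1 - (σ₂ : ℝ) • x.2) j : AddCircle (1 : ℝ)) := fun x => by
      funext j
      exact (congrArg₂ (· - ·) (zsmul_coe_circle _ _) (zsmul_coe_circle _ _)).trans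
        (AddCircle.coe_sub (1 : ℝ) _ _).symm
    simp only [Ψ, hadd, hsub]
    exact (((contDiff_cutoffTorus δ contDiff_fst).mul (contDiff_cutoffTorus δ contDiff_snd)).mul
      (contDiff_cutoffTorus δ (by fun_prop))).mul (contDiff_cutoffTorus δ (by fun_prop))
  have hle : ∀ k₁ k₂, Ψ k₁ k₂ ≤ cutoffTorus δ k₁ ∧ Ψ k₁ k₂ ≤ cutoffTorus δ k₂ ∧
      Ψ k₁ k₂ ≤ cutoffTorus δ (σ₁ • k₁ + σ₂ • k₂) ∧
      Ψ k₁ k₂ ≤ cutoffTorus δ (σ₁ • k₁ - σ₂ • k₂) := by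
    intro k₁ k₂
    have h₁ := cutoffTorus_mem_Icc δ k₁
    have h₂ := cutoffTorus_mem_Icc δ k₂
    have h₃ := cutoffTorus_mem_Icc δ (σ₁ • k₁ + σ₂ • k₂)
    have h₄ := cutoffTorus_mem_Icc δ (σ₁ • k₁ - σ₂ • k₂)
    have h₁₂ := unitInterval.mul_mem h₁ h₂
    have h₁₂₃ := unitInterval.mul_mem h₁₂ h₃
    have hΨ := mul_le_of_le_one_right h₁₂₃.1 h₄.2
    have hΨ' := hΨ.trans (mul_le_of_le_one_right h₁₂.1 h₃.2)
    exact ⟨hΨ'.trans (mul_le_of_le_one_right h₁.1 h₂.2),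
      hΨ'.trans (mul_le_of_le_one_left h₂.1 h₁.2),
      hΨ.trans (mul_le_of_le_one_left h₃.1 h₁₂.2),
      mul_le_of_le_one_left h₄.1 h₁₂₃.2⟩
  have hzero : cutoffTorus δ (0 : Fin d → AddCircle (1 : ℝ)) ≤ 0 := by
    simpa [Metric.infDist_zero_of_mem (zero_mem_singS hd0)] using
      cutoffTorus_le_infDist hd0 hδ (0 : Fin d → AddCircle (1 : ℝ))
  refine ⟨fun k₁ k₂ => 1 - Ψ k₁ k₂, Ψ, fun k₁ k₂ => by ring, fun k₁ k₂ => ?_, hIcc,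
    contDiff_const.sub hsmooth, hsmooth, fun k₁ k₂ h => ?_, fun k₁ k₂ => ?_, fun k₁ k₂ => ?_⟩
  · exact ⟨sub_nonneg.2 (hIcc k₁ k₂).2, sub_le_self _ (hIcc k₁ k₂).1⟩
  · obtain ⟨h₁, h₂, h₃, h₄⟩ := hle k₁ k₂
    refine le_antisymm ?_ (hIcc k₁ k₂).1
    rcases h with h | h | h | h
    · exact (h ▸ h₃).trans hzero
    · exact (h ▸ h₄).trans hzero
    · exact h₁.trans (h ▸ hzero)
    · exact h₂.trans (h ▸ hzero)
  · obtain ⟨h₁, h₂, h₃, h₄⟩ := hle k₁ k₂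
    exact ⟨h₁.trans (cutoffTorus_le_infDist hd0 hδ _), h₂.trans (cutoffTorus_le_infDist hd0 hδ _),
      h₃.trans (cutoffTorus_le_infDist hd0 hδ _), h₄.trans (cutoffTorus_le_infDist hd0 hδ _)⟩
  · have h0 := (hIcc k₁ k₂).1
    by_cases h : δ ≤ Metric.infDist (σ₁ • k₁ + σ₂ • k₂) (singS d) ∧
        δ ≤ Metric.infDist (σ₁ • k₁ - σ₂ • k₂) (singS d) ∧
        δ ≤ Metric.infDist k₁ (singS d) ∧ δ ≤ Metric.infDist k₂ (singS d)
    · obtain ⟨h₁, h₂, h₃, h₄⟩ := h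
      have hΨ : Ψ k₁ k₂ = 1 := by
        simp only [Ψ, cutoffTorus_eq_one hδ h₁, cutoffTorus_eq_one hδ h₂,
          cutoffTorus_eq_one hδ h₃, cutoffTorus_eq_one hδ h₄, mul_one]
      simp [hΨ, h₁.not_gt, h₂.not_gt, h₃.not_gt, h₄.not_gt]
    · simp only [not_and_or, not_le] at h
      rcases h with h | h | h | h <;> split_ifs <;> linarith
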